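/- For every positive integer e, setting q = 3^{2e}, there exists a set K of points of the affine plane AG(2,q), i.e. K ⊆ 𝔽_q × 𝔽_q, with |K| = (q² − q)/2, such that every affine line meets K in exactly (q − 3^e)/2 points or exactly (q + 3^e)/2 points, and both intersection sizes occur; that is, K is a set of type ((3^{2e} − 3^e)/2, (3^{2e} + 3^e)/2) in AG(2, 3^{2e}). -/

import Mathlib

section PartD
variable {F : Type*} [Field F] [Fintype F] [DecidableEq F]

lemma pd_T (f : F × F → ℤ) (q : ℕ) (hq : Fintype.card F = q)
    (hf : ∀ p, f p ^ 2 = 1)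
    (hL : ∀ a d : F × F, d ≠ 0 → (∑ t : F, f (a + t • d)) ^ 2 = q) :
    (∑ p, f p) ^ 2 = (q : ℤ) ^ 2 := by
  have hcard : Fintype.card (F × F) = q ^ 2 := by
    rw [Fintype.card_prod, hq]; ring
  have hq1 : 1 < q := hq ▸ Fintype.one_lt_card
  set T := ∑ p, f p with hT
  set C : F × F → ℤ := fun x => ∑ a, f a * f (a + x) with hC
  have hCs : ∑ x, C x = T ^ 2 := by
    simp only [hC]
    rw [Finset.sum_comm, sq, hT, Finset.sum_mul_sum]
    refine Finset.sum_congr rfl fun a _ => ?_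
    exact Fintype.sum_equiv (Equiv.addLeft a) _ _ (fun x => rfl)
  have hC0 : C 0 = (q : ℤ) ^ 2 := by
    simp only [hC, add_zero]
    rw [Finset.sum_congr rfl (fun a _ => by rw [← sq, hf])]
    simp only [Finset.sum_const, Finset.card_univ, hcard]; simp
  have h1 : ∀ d : F × F, ∑ a, (∑ t : F, f (a + t • d)) ^ 2 = q * ∑ t : F, C (t • d) := by
    intro d
    have : ∀ a : F × F, (∑ t : F, f (a + t • d)) ^ 2
        = ∑ t : F, ∑ u : F, f (a + t • d) * f (a + t • d + u • d) := by
      intro a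
      rw [sq, Finset.sum_mul_sum]
      refine Finset.sum_congr rfl fun t _ => ?_
      refine (Fintype.sum_equiv (Equiv.addLeft t) _ _ (fun u => ?_)).symm
      simp [add_smul, add_assoc]
    rw [Finset.sum_congr rfl (fun a _ => this a), Finset.sum_comm]
    have h2 : ∀ t : F, ∑ a : F × F, ∑ u : F, f (a + t • d) * f (a + t • d + u • d)
        = ∑ u : F, C (u • d) := by
      intro t
      rw [Finset.sum_comm]
      refine Finset.sum_congr rfl fun u _ => ?_
      exact Fintype.sum_equiv (Equiv.addRight (t • d)) _ _ (fun x => rfl)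
    rw [Finset.sum_congr rfl (fun t _ => h2 t)]
    simp [hq]
  have h3 : ∑ d : F × F, ∑ a, (∑ t : F, f (a + t • d)) ^ 2
      = q * ((q:ℤ) ^ 2 * q ^ 2 + (q - 1) * T ^ 2) := by
    rw [Finset.sum_congr rfl (fun d _ => h1 d), ← Finset.mul_sum, Finset.sum_comm]
    congr 1
    have h4 : ∀ t : F, t ≠ 0 → ∑ d : F × F, C (t • d) = T ^ 2 := by
      intro t ht
      rw [← hCs]
      exact Fintype.sum_equiv (MulAction.toPerm (Units.mk0 t ht)) _ _ (fun x => rfl)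
    rw [← Finset.add_sum_erase _ _ (Finset.mem_univ (0:F)),
      Finset.sum_congr rfl (fun t ht => h4 t (Finset.ne_of_mem_erase ht))]
    simp only [zero_smul, hC0, Finset.sum_const, Finset.card_univ, hcard,
      Finset.card_erase_of_mem (Finset.mem_univ (0:F)), hq, nsmul_eq_mul]
    push_cast [Nat.cast_sub hq1.le]
    ring
  have h5 : ∑ d : F × F, ∑ a, (∑ t : F, f (a + t • d)) ^ 2
      = (q:ℤ) ^ 2 * q ^ 2 + ((q:ℤ) ^ 2 - 1) * (q ^ 2 * q) := by
    rw [← Finset.add_sum_erase _ _ (Finset.mem_univ (0:F × F)),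
      Finset.sum_congr rfl (fun d hd => Finset.sum_congr rfl
        (fun a _ => hL a d (Finset.ne_of_mem_erase hd)))]
    simp only [smul_zero, add_zero, Finset.sum_const, Finset.card_univ, hcard, hq, nsmul_eq_mul,
      Finset.card_erase_of_mem (Finset.mem_univ (0:F × F)), mul_pow, hf]
    have : 1 ≤ q ^ 2 := Nat.one_le_pow _ _ (by omega)
    push_cast [Nat.cast_sub this]
    ring
  have h6 : (q:ℤ) * (q - 1) * (T ^ 2 - q ^ 2) = 0 := by
    have := h3.symm.trans h5
    linear_combination this
  have hqz : (1:ℤ) < q := by exact_mod_cast hq1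
  rcases mul_eq_zero.1 h6 with h | h
  · rcases mul_eq_zero.1 h with h | h <;> omega
  · linarith

lemma pd_count {ι : Type*} [Fintype ι] (g : ι → ℤ) (hg : ∀ i, g i = 1 ∨ g i = -1) :
    (2 * {i | g i = -1}.ncard : ℤ) = Fintype.card ι - ∑ i, g i := by
  classical
  have h : ∀ i, g i = 1 - 2 * (if g i = -1 then 1 else 0) := by
    intro i; rcases hg i with h | h <;> simp [h]
  rw [Finset.sum_congr rfl (fun i _ => h i), Finset.sum_sub_distrib, ← Finset.mul_sum,
    Finset.sum_boole, Set.ncard_eq_toFinset_card']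
  simp

lemma pd_main (e : ℕ) (he : 0 < e) (hF : Fintype.card F = 3 ^ (2 * e)) (f : F × F → ℤ)
    (hf : ∀ p, f p ^ 2 = 1)
    (hL : ∀ a d : F × F, d ≠ 0 → (∑ t : F, f (a + t • d)) ^ 2 = ((3 ^ (2 * e) : ℕ) : ℤ)) :
    ∃ K : Set (F × F),
      K.ncard = (3 ^ (2 * e) * 3 ^ (2 * e) - 3 ^ (2 * e)) / 2 ∧
      (∀ a d : F × F, d ≠ 0 →
        {x ∈ K | ∃ t : F, x = a + t • d}.ncard = (3 ^ (2 * e) - 3 ^ e) / 2 ∨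
        {x ∈ K | ∃ t : F, x = a + t • d}.ncard = (3 ^ (2 * e) + 3 ^ e) / 2) ∧
      (∃ a d : F × F, d ≠ 0 ∧
        {x ∈ K | ∃ t : F, x = a + t • d}.ncard = (3 ^ (2 * e) - 3 ^ e) / 2) ∧
      (∃ a d : F × F, d ≠ 0 ∧
        {x ∈ K | ∃ t : F, x = a + t • d}.ncard = (3 ^ (2 * e) + 3 ^ e) / 2) := by
  have hT := pd_T f _ hF hf hL
  have hqs : 3 ^ (2 * e) = 3 ^ e * 3 ^ e := by rw [← pow_add]; congr 1; ring
  have hs3 : 3 ≤ 3 ^ e := by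
    calc 3 = 3 ^ 1 := by norm_num
      _ ≤ 3 ^ e := Nat.pow_le_pow_right (by norm_num) he
  rw [hqs] at hF hT hL ⊢
  generalize 3 ^ e = s at *
  obtain ⟨σ, hσ, hσT⟩ : ∃ σ : ℤ, σ ^ 2 = 1 ∧ σ * ∑ p, f p = s * s := by
    rcases sq_eq_sq_iff_eq_or_eq_neg.1 hT with h | h
    · exact ⟨1, by norm_num, by rw [h]; push_cast; ring⟩
    · exact ⟨-1, by norm_num, by rw [h]; push_cast; ring⟩
  have hg : ∀ p, σ * f p = 1 ∨ σ * f p = -1 := by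
    intro p
    exact sq_eq_one_iff.1 (by rw [mul_pow, hσ, hf, one_mul])
  have hline : ∀ a d : F × F, d ≠ 0 →
      (2 * {x ∈ {p | σ * f p = -1} | ∃ t : F, x = a + t • d}.ncard : ℤ)
        = s * s - σ * ∑ t : F, f (a + t • d) := by
    intro a d hd
    have h1 : {x ∈ {p | σ * f p = -1} | ∃ t : F, x = a + t • d}
        = (fun t : F => a + t • d) '' {t | σ * f (a + t • d) = -1} := by
      ext x
      constructor
      · rintro ⟨hx, t, rfl⟩
        exact ⟨t, hx, rfl⟩
      · rintro ⟨t, ht, rfl⟩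
        exact ⟨ht, t, rfl⟩
    rw [h1, Set.ncard_image_of_injective, pd_count _ (fun t => hg _), hF, ← Finset.mul_sum]
    · push_cast; ring
    · intro t u htu
      exact smul_left_injective F hd (add_left_cancel htu)
  have hpm : ∀ a d : F × F, d ≠ 0 → σ * ∑ t : F, f (a + t • d) = s ∨
      σ * ∑ t : F, f (a + t • d) = -s := by
    intro a d hd
    apply sq_eq_sq_iff_eq_or_eq_neg.1
    rw [mul_pow, hσ, hL a d hd]; push_cast; ring
  have hss : s ≤ s * s := Nat.le_mul_self s
  have hlow : ∀ a d : F × F, d ≠ 0 → σ * ∑ t : F, f (a + t • d) = s →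
      {x ∈ {p | σ * f p = -1} | ∃ t : F, x = a + t • d}.ncard = (s * s - s) / 2 := by
    intro a d hd h
    have := hline a d hd
    rw [h] at this
    have : 2 * {x ∈ {p | σ * f p = -1} | ∃ t : F, x = a + t • d}.ncard + s = s * s := by
      zify; linarith
    omega
  have hhigh : ∀ a d : F × F, d ≠ 0 → σ * ∑ t : F, f (a + t • d) = -s →
      {x ∈ {p | σ * f p = -1} | ∃ t : F, x = a + t • d}.ncard = (s * s + s) / 2 := by
    intro a d hd h
    have := hline a d hd
    rw [h] at this
    have : 2 * {x ∈ {p | σ * f p = -1} | ∃ t : F, x = a + t • d}.ncard = s * s + s := by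
      zify; linarith
    omega
  have hd0 : ((1, 0) : F × F) ≠ 0 := by simp
  have hcard : Fintype.card (F × F) = s * s * (s * s) := by
    rw [Fintype.card_prod, hF]
  have hsum : ∑ a : F × F, σ * ∑ t : F, f (a + t • ((1, 0) : F × F)) = (s * s) * (s * s) := by
    rw [← Finset.mul_sum, Finset.sum_comm]
    have : ∀ t : F, ∑ a : F × F, f (a + t • ((1, 0) : F × F)) = ∑ p, f p := fun t =>
      Fintype.sum_equiv (Equiv.addRight (t • ((1, 0) : F × F))) _ _ (fun x => rfl)
    rw [Finset.sum_congr rfl (fun t _ => this t), Finset.sum_const, Finset.card_univ, hF,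
      nsmul_eq_mul, mul_left_comm, hσT]
    push_cast; ring
  have hsz : (3:ℤ) ≤ s := by exact_mod_cast hs3
  refine ⟨{p | σ * f p = -1}, ?_, ?_, ?_, ?_⟩
  · have := pd_count _ hg
    rw [← Finset.mul_sum, hσT, hcard] at this
    have h2 : 2 * {p | σ * f p = -1}.ncard + s * s = s * s * (s * s) := by
      zify; push_cast at this; linarith
    omega
  · intro a d hd
    rcases hpm a d hd with h | h
    · exact Or.inl (hlow a d hd h)
    · exact Or.inr (hhigh a d hd h)
  · by_contra hcon
    push Not at hcon
    have : ∀ a : F × F, σ * ∑ t : F, f (a + t • ((1, 0) : F × F)) = -s := fun a =>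
      (hpm a _ hd0).resolve_left (fun h => hcon a _ hd0 (hlow a _ hd0 h))
    rw [Finset.sum_congr rfl (fun a _ => this a), Finset.sum_const, Finset.card_univ, hcard,
      nsmul_eq_mul] at hsum
    push_cast at hsum
    have : (0:ℤ) < s * s * (s * s) := by positivity
    nlinarith
  · by_contra hcon
    push Not at hcon
    have : ∀ a : F × F, σ * ∑ t : F, f (a + t • ((1, 0) : F × F)) = s := fun a =>
      (hpm a _ hd0).resolve_right (fun h => hcon a _ hd0 (hhigh a _ hd0 h))
    rw [Finset.sum_congr rfl (fun a _ => this a), Finset.sum_const, Finset.card_univ, hcard,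
      nsmul_eq_mul] at hsum
    push_cast at hsum
    have : (0:ℤ) < s * s * (s * s) := by positivity
    nlinarith
end PartD

section PartA
open ComplexConjugate
set_option linter.unusedSectionVars false
variable {F : Type*} [Field F] [Fintype F] [DecidableEq F]

lemma pa_three {F : Type*} [Field F] [CharP F 3] : (3:F) = 0 := by
  exact_mod_cast CharP.cast_eq_zero F 3

lemma pa_psi_cube [CharP F 3] (ψ : AddChar F ℂ) (x : F) : ψ x ^ 3 = 1 := by
  rw [← AddChar.map_nsmul_eq_pow]
  have : (3:ℕ) • x = 0 := by rw [nsmul_eq_mul]; push_cast; rw [pa_three, zero_mul]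
  rw [this, AddChar.map_zero_eq_one]

lemma pa_psi_int [CharP F 3] (ψ : AddChar F ℂ) (x : F) : IsIntegral ℤ (ψ x) := by
  refine IsIntegral.of_pow (n := 3) (by norm_num) ?_
  rw [pa_psi_cube]; exact isIntegral_one

lemma pa_lin [CharP F 3] (ψ : AddChar F ℂ) (a b : F) :
    ∃ m : ℤ, ∑ ρ : F, ψ (a * ρ ^ 3 + b * ρ) = (Fintype.card F : ℂ) * m := by
  classical
  let φ : AddChar F ℂ :=
    { toFun := fun ρ => ψ (a * ρ ^ 3 + b * ρ)
      map_zero_eq_one' := by simp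
      map_add_eq_mul' := by
        intro x y
        rw [← AddChar.map_add_eq_mul]
        congr 1
        linear_combination (a * (x ^ 2 * y + x * y ^ 2)) * pa_three (F := F) }
  have h : ∑ ρ : F, φ ρ = if φ = 0 then (Fintype.card F : ℂ) else 0 := AddChar.sum_eq_ite φ
  change ∃ m : ℤ, ∑ ρ : F, φ ρ = _
  rw [h]
  split_ifs
  · exact ⟨1, by simp⟩
  · exact ⟨0, by simp⟩

lemma pa_W [CharP F 3] (ψ : AddChar F ℂ) (s : ℂ) (hs0 : s ≠ 0)
    (hs : s ^ 2 = Fintype.card F) (α β : F) :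
    ∃ z : ℂ, IsIntegral ℤ z ∧ ∑ ρ : F, ψ (α * ρ ^ 4 + β * ρ ^ 2) = s * z := by
  have h3 := pa_three (F := F)
  set Q : F → F := fun ρ => α * ρ ^ 4 + β * ρ ^ 2 with hQ
  change ∃ z : ℂ, IsIntegral ℤ z ∧ ∑ ρ : F, ψ (Q ρ) = s * z
  set W := ∑ ρ : F, ψ (Q ρ) with hW
  set V := ∑ ρ : F, ψ (-(Q ρ)) with hV
  have h1 : ∃ r : ℂ, IsIntegral ℤ r ∧ W * V = s ^ 2 * r := by
    choose m hm using fun δ : F => pa_lin ψ (α * δ) (α * δ ^ 3 + 2 * β * δ)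
    refine ⟨∑ δ : F, ψ (Q δ) * m δ, IsIntegral.sum _ fun δ _ =>
      (pa_psi_int ψ _).mul (isIntegral_algebraMap (x := m δ)), ?_⟩
    rw [mul_comm W V, hV, hW, Finset.sum_mul_sum]
    have : ∀ ρ : F, ∑ j : F, ψ (-(Q ρ)) * ψ (Q j)
        = ∑ δ : F, ψ (Q δ) * ψ (α * δ * ρ ^ 3 + (α * δ ^ 3 + 2 * β * δ) * ρ) := by
      intro ρ
      refine (Fintype.sum_equiv (Equiv.addLeft ρ) _ _ fun δ => ?_).symm
      rw [← AddChar.map_add_eq_mul, ← AddChar.map_add_eq_mul]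
      congr 1
      simp only [hQ, Equiv.coe_addLeft]
      linear_combination (-(α * (ρ ^ 3 * δ + 2 * ρ ^ 2 * δ ^ 2 + ρ * δ ^ 3))) * h3
    rw [Finset.sum_congr rfl fun ρ _ => this ρ, Finset.sum_comm, Finset.mul_sum]
    refine Finset.sum_congr rfl fun δ _ => ?_
    rw [← Finset.mul_sum, hm, hs]; ring
  have h2 : W ^ 2 = V ^ 2 := by
    rw [sq, sq, hW, hV, Finset.sum_mul_sum, Finset.sum_mul_sum, ← Finset.sum_product',
      ← Finset.sum_product']
    let E : F × F ≃ F × F :=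
      { toFun := fun p => (p.1 + p.2, p.1 - p.2)
        invFun := fun p => (-(p.1 + p.2), -(p.1 - p.2))
        left_inv := by
          rintro ⟨x, y⟩
          ext
          · simp only; linear_combination (-x) * h3
          · simp only; linear_combination (-y) * h3
        right_inv := by
          rintro ⟨x, y⟩
          ext
          · simp only; linear_combination (-x) * h3
          · simp only; linear_combination (-y) * h3 }
    refine (Fintype.sum_equiv E _ _ fun p => ?_).symm
    obtain ⟨x, y⟩ := p
    rw [← AddChar.map_add_eq_mul, ← AddChar.map_add_eq_mul]
    congr 1
    simp only [hQ, E, Equiv.coe_fn_mk]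
    linear_combination (-(α * (x ^ 4 + 4 * x ^ 2 * y ^ 2 + y ^ 4) + β * (x ^ 2 + y ^ 2))) * h3
  obtain ⟨r, hr, hWV⟩ := h1
  refine ⟨W / s, ?_, by field_simp⟩
  refine IsIntegral.of_pow (n := 4) (by norm_num) ?_
  have : (W / s) ^ 4 = r ^ 2 := by
    have : W ^ 4 = (s ^ 2 * r) ^ 2 := by
      rw [← hWV, mul_pow, ← h2]; ring
    rw [div_pow, this]; field_simp
  rw [this]
  exact hr.pow 2

lemma pa_ringChar [CharP F 3] : ringChar F ≠ 2 := by
  rw [ringChar.eq F 3]; norm_num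

/-- quadratic character with complex values -/
noncomputable def qc (x : F) : ℂ := ((quadraticChar F x : ℤ) : ℂ)

lemma qc_mul (x y : F) : qc (x * y) = qc x * qc y := by
  simp only [qc]; rw [map_mul]; push_cast; rfl

lemma qc_zero : qc (0 : F) = 0 := by simp [qc]

lemma qc_sq (x : F) (hx : x ≠ 0) : qc (x ^ 2) = 1 := by
  simp only [qc]; rw [quadraticChar_sq_one' hx]; simp

lemma pa_SQ [CharP F 3] (f : F → ℂ) : ∑ τ : F, f (τ ^ 2) = ∑ u : F, (1 + qc u) * f u := by
  rw [← Finset.sum_fiberwise (s := Finset.univ) (g := fun τ : F => τ ^ 2)]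
  refine Finset.sum_congr rfl fun u _ => ?_
  have h := quadraticChar_card_sqrts (F := F) pa_ringChar u
  have h2 : (({x : F | x ^ 2 = u}.toFinset.card : ℤ) : ℂ) = qc u + 1 := by
    rw [h]; simp [qc]
  rw [Finset.sum_congr rfl (g := fun _ => f u) (fun x hx => by
    rw [(Finset.mem_filter.1 hx).2]), Finset.sum_const, nsmul_eq_mul, add_comm 1, ← h2]
  congr 1
  push_cast
  congr 2
  ext x; simp

lemma pa_fib [CharP F 3] (f : F → ℂ) :
    ∑ ν ∈ Finset.univ.erase (0:F), f (ν + ν⁻¹) = ∑ r : F, (1 + qc (r ^ 2 - 1)) * f r := by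
  have h3 := pa_three (F := F)
  rw [← Finset.sum_fiberwise (s := Finset.univ.erase (0:F)) (g := fun τ : F => τ + τ⁻¹)]
  refine Finset.sum_congr rfl fun r _ => ?_
  have h := quadraticChar_card_sqrts (F := F) pa_ringChar (r ^ 2 - 1)
  have h2 : (({x : F | x ^ 2 = r ^ 2 - 1}.toFinset.card : ℤ) : ℂ) = qc (r ^ 2 - 1) + 1 := by
    rw [h]; simp [qc]
  rw [Finset.sum_congr rfl (g := fun _ => f r) (fun x hx => by
    rw [(Finset.mem_filter.1 hx).2]), Finset.sum_const, nsmul_eq_mul, add_comm 1, ← h2]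
  congr 1
  push_cast
  congr 1
  refine Finset.card_bij (fun ν _ => ν + r) ?_ ?_ ?_
  · intro ν hν
    simp only [Finset.mem_filter, Finset.mem_erase, Finset.mem_univ, and_true] at hν
    obtain ⟨h0, h1⟩ := hν
    simp only [Set.mem_toFinset, Set.mem_ofPred_eq]
    have : ν * ν + 1 = r * ν := by rw [← h1]; field_simp
    linear_combination this + (r * ν) * h3
  · intro a _ b _ hab
    exact add_right_cancel hab
  · intro b hb
    simp only [Set.mem_toFinset, Set.mem_ofPred_eq] at hb
    have hne : b - r ≠ 0 := by
      intro h
      have : b = r := sub_eq_zero.1 h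
      subst this
      have : (1:F) = 0 := by linear_combination hb
      exact one_ne_zero this
    refine ⟨b - r, ?_, by ring⟩
    simp only [Finset.mem_filter, Finset.mem_erase, Finset.mem_univ, and_true]
    refine ⟨hne, ?_⟩
    field_simp
    linear_combination hb + (r ^ 2 - b * r) * h3

lemma pa_fiber [CharP F 3] (hm : qc (-1 : F) = 1) (f : F → ℂ) :
    ∑ ν : F, qc ν * f (ν + ν⁻¹) = ∑ r : F, f r * (qc (r + 2) + qc (r - 2)) := by
  have h3 := pa_three (F := F)
  have hz : ∑ ν : F, qc ν * f (ν + ν⁻¹) = f (-2) +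
      ∑ ν ∈ Finset.univ.erase (0:F), qc (ν + ν⁻¹ + 2) * f (ν + ν⁻¹) := by
    rw [← Finset.add_sum_erase _ _ (Finset.mem_univ (0:F)), qc_zero, zero_mul, zero_add]
    have hmem : (-1 : F) ∈ Finset.univ.erase (0:F) := by simp
    rw [← Finset.add_sum_erase _ _ hmem, ← Finset.add_sum_erase _ (fun ν : F =>
      qc (ν + ν⁻¹ + 2) * f (ν + ν⁻¹)) hmem]
    have e1 : (-1 : F) + (-1)⁻¹ = -2 := by norm_num
    rw [hm, e1, neg_add_cancel, qc_zero, one_mul, zero_mul, zero_add]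
    congr 1
    refine Finset.sum_congr rfl fun ν hν => ?_
    simp only [Finset.mem_erase, Finset.mem_univ, and_true] at hν
    obtain ⟨h1, h0⟩ := hν
    congr 1
    have h4 : qc ((ν + 1) ^ 2) = 1 := qc_sq _ (fun h => h1 (by linear_combination h))
    have h5 : ν * (ν + ν⁻¹ + 2) = (ν + 1) ^ 2 := by field_simp; ring
    have h6 : qc (ν ^ 2) = 1 := qc_sq _ h0
    rw [← h5, qc_mul] at h4
    rw [sq, qc_mul] at h6
    linear_combination (-qc ν) * h4 + (qc (ν + ν⁻¹ + 2)) * h6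
  rw [hz, pa_fib (fun r => qc (r + 2) * f r)]
  rw [← Finset.add_sum_erase _ _ (Finset.mem_univ (-2:F)),
    ← Finset.add_sum_erase _ (fun r => f r * (qc (r + 2) + qc (r - 2))) (Finset.mem_univ (-2:F))]
  have e2 : (-2 : F) - 2 = -1 := by linear_combination (-1) * h3
  rw [neg_add_cancel, qc_zero, e2, hm]
  have : ∀ a b c : ℂ, b = c → f (-2) + (a * (0 * f (-2)) + b) = f (-2) * (0 + 1) + c := by
    intro a b c h; rw [h]; ring
  apply this
  refine Finset.sum_congr rfl fun r hr => ?_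
  have hr2 : r ≠ -2 := Finset.ne_of_mem_erase hr
  have e3 : r ^ 2 - 1 = (r + 2) * (r - 2) := by linear_combination h3
  have h6 : qc ((r + 2) ^ 2) = 1 := qc_sq _ (fun h => hr2 (by linear_combination h))
  rw [sq, qc_mul] at h6
  rw [e3, qc_mul]
  linear_combination (qc (r - 2) * f r) * h6

lemma pa_K4 [CharP F 3] (χ : MulChar F ℂ) (hχ : ∀ a, χ a ^ 2 = qc a) (ψ : AddChar F ℂ) (s : ℂ)
    (hs0 : s ≠ 0) (hs : s ^ 2 = Fintype.card F) (ε : F) :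
    ∃ z : ℂ, IsIntegral ℤ z ∧ ∑ l : F, χ l ^ 3 * ψ (ε * (l + l⁻¹)) = s * z := by
  have h3 := pa_three (F := F)
  have hm : qc (-1 : F) = 1 := by
    rw [← hχ, ← map_pow]; simp
  have hχ4 : ∀ a : F, a ≠ 0 → χ a ^ 4 = 1 := by
    intro a ha
    have := qc_sq a ha
    rw [← hχ, map_pow] at this
    rw [← this]; ring
  set K := ∑ l : F, χ l ^ 3 * ψ (ε * (l + l⁻¹)) with hK
  have h1 : K = ∑ l : F, χ l * ψ (ε * (l + l⁻¹)) := by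
    refine Fintype.sum_equiv (Equiv.inv F) _ _ fun l => ?_
    simp only [Equiv.inv_apply, inv_inv]
    rw [add_comm l⁻¹]
    congr 1
    rcases eq_or_ne l 0 with rfl | hl
    · simp [MulChar.map_zero]
    · have h4 := hχ4 l hl
      have : χ l * χ l⁻¹ = 1 := by rw [← map_mul, mul_inv_cancel₀ hl, map_one]
      linear_combination (χ l⁻¹) * h4 - (χ l ^ 3) * this
  have h2 : 2 * K = ∑ ν : F, qc ν * ψ (ε * ((ν + ν⁻¹) ^ 2 - 2)) := by
    have : ∑ ν : F, qc ν * ψ (ε * ((ν + ν⁻¹) ^ 2 - 2))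
        = ∑ ν : F, (fun u => χ u * ψ (ε * (u + u⁻¹))) (ν ^ 2) := by
      refine Finset.sum_congr rfl fun ν _ => ?_
      simp only [map_pow, hχ]
      rcases eq_or_ne ν 0 with rfl | hν
      · simp [qc_zero]
      · congr 3
        field_simp; ring
    rw [this, pa_SQ (fun u => χ u * ψ (ε * (u + u⁻¹))), two_mul]
    nth_rewrite 1 [h1]
    rw [hK, ← Finset.sum_add_distrib]
    refine Finset.sum_congr rfl fun u _ => ?_
    rw [← hχ]; ring
  have h5 : K = ∑ r : F, qc (r + 2) * ψ (ε * (r ^ 2 - 2)) := by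
    rw [pa_fiber hm (fun r => ψ (ε * (r ^ 2 - 2)))] at h2
    have h6 : ∑ r : F, ψ (ε * (r ^ 2 - 2)) * qc (r - 2)
        = ∑ r : F, ψ (ε * (r ^ 2 - 2)) * qc (r + 2) := by
      refine Fintype.sum_equiv (Equiv.neg F) _ _ fun r => ?_
      simp only [Equiv.neg_apply, neg_sq]
      congr 1
      have : -r + 2 = -1 * (r - 2) := by ring
      rw [this, qc_mul, hm, one_mul]
    simp only [mul_add] at h2
    rw [Finset.sum_add_distrib, h6] at h2
    rw [Finset.sum_congr rfl (fun r _ => mul_comm (qc (r + 2)) (ψ (ε * (r ^ 2 - 2))))]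
    linear_combination h2 / 2
  have h6 : K = ψ (2 * ε) * ∑ ρ : F, ψ (ε * ρ ^ 4 + (-ε) * ρ ^ 2)
      - ψ (-2 * ε) * ∑ ρ : F, ψ (0 * ρ ^ 4 + ε * ρ ^ 2) := by
    have e1 : K = ∑ u : F, qc u * ψ (ε * ((u - 2) ^ 2 - 2)) := by
      rw [h5]
      refine Fintype.sum_equiv (Equiv.addRight 2) _ _ fun u => ?_
      simp
    have e2 : ∑ u : F, ψ (ε * ((u - 2) ^ 2 - 2)) = ψ (-2 * ε) * ∑ ρ : F, ψ (0 * ρ ^ 4 + ε * ρ ^ 2) := by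
      rw [Finset.mul_sum]
      refine Fintype.sum_equiv (Equiv.subRight 2) _ _ fun u => ?_
      rw [← AddChar.map_add_eq_mul]
      congr 1
      simp only [Equiv.subRight_apply]; ring
    have e3 := pa_SQ (fun u => ψ (ε * ((u - 2) ^ 2 - 2)))
    have e4 : ∑ τ : F, ψ (ε * ((τ ^ 2 - 2) ^ 2 - 2))
        = ψ (2 * ε) * ∑ ρ : F, ψ (ε * ρ ^ 4 + (-ε) * ρ ^ 2) := by
      rw [Finset.mul_sum]
      refine Finset.sum_congr rfl fun u _ => ?_
      rw [← AddChar.map_add_eq_mul]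
      congr 1
      linear_combination (-ε * u ^ 2) * h3
    rw [← e2, ← e4, e3, e1, ← Finset.sum_sub_distrib]
    refine Finset.sum_congr rfl fun u _ => ?_
    ring
  obtain ⟨z1, hz1, hw1⟩ := pa_W ψ s hs0 hs ε (-ε)
  obtain ⟨z2, hz2, hw2⟩ := pa_W ψ s hs0 hs 0 ε
  refine ⟨ψ (2 * ε) * z1 - ψ (-2 * ε) * z2,
    ((pa_psi_int ψ _).mul hz1).sub ((pa_psi_int ψ _).mul hz2), ?_⟩
  rw [h6, hw1, hw2]; ring

lemma pa_conj_int {z : ℂ} (hz : IsIntegral ℤ z) : IsIntegral ℤ (conj z) :=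
  map_isIntegral_int (starRingEnd ℂ) hz

lemma pa_chi4 (χ : MulChar F ℂ) (hχ : ∀ a, χ a ^ 2 = qc a) (a : F) (ha : a ≠ 0) :
    χ a ^ 4 = 1 := by
  have := qc_sq a ha
  rw [← hχ, map_pow] at this
  rw [← this]; ring

lemma pa_chi_int (χ : MulChar F ℂ) (hχ : ∀ a, χ a ^ 2 = qc a) (a : F) : IsIntegral ℤ (χ a) := by
  rcases eq_or_ne a 0 with rfl | ha
  · rw [MulChar.map_zero]; exact isIntegral_zero
  · refine IsIntegral.of_pow (n := 4) (by norm_num) ?_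
    rw [pa_chi4 χ hχ a ha]; exact isIntegral_one

lemma pa_chi_norm (χ : MulChar F ℂ) (a : F) (ha : a ≠ 0) : χ a * conj (χ a) = 1 := by
  have : conj (χ a) = χ⁻¹ a := MulChar.star_apply' χ a
  rw [this, ← MulChar.mul_apply, mul_inv_cancel, MulChar.one_apply ha.isUnit]

lemma pa_gauss_norm (χ : MulChar F ℂ) (hχ : χ ≠ 1) (ψ : AddChar F ℂ) (hψ : ψ.IsPrimitive) :
    gaussSum χ ψ * conj (gaussSum χ ψ) = Fintype.card F := by
  have h : conj (gaussSum χ ψ) = gaussSum χ⁻¹ ψ⁻¹ := by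
    simp only [gaussSum, map_sum, map_mul]
    refine Finset.sum_congr rfl fun x _ => ?_
    congr 1
    · exact MulChar.star_apply' χ x
    · rw [AddChar.inv_apply, AddChar.map_neg_eq_conj]
  rw [h, gaussSum_mul_gaussSum_eq_card hχ hψ]

lemma pa_gauss_shift (χ : MulChar F ℂ) (ψ : AddChar F ℂ) (x : F) (hx : x ≠ 0) :
    ∑ l : F, χ l * ψ (l * x) = χ x⁻¹ * gaussSum χ ψ := by
  rw [gaussSum, Finset.mul_sum]
  refine Fintype.sum_equiv (Equiv.mulRight₀ x hx) _ _ fun l => ?_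
  change _ = χ x⁻¹ * (χ (l * x) * ψ (l * x))
  rw [← mul_assoc, ← map_mul, mul_comm l x, inv_mul_cancel_left₀ hx]

lemma pa_quad [CharP F 3] (χ : MulChar F ℂ) (hχ : ∀ a, χ a ^ 2 = qc a) (ψ : AddChar F ℂ)
    (hψ : ψ.IsPrimitive) (κ : F) (hκ : κ ≠ 0) :
    ∑ τ : F, ψ (κ * τ ^ 2) = qc κ * gaussSum (χ ^ 2) ψ := by
  rw [pa_SQ (fun u => ψ (κ * u))]
  have h1 : ∑ u : F, ψ (κ * u) = 0 := by
    have := AddChar.sum_mulShift κ hψ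
    rw [if_neg hκ] at this
    rw [← Nat.cast_zero, ← this]
    exact Finset.sum_congr rfl fun u _ => by rw [mul_comm]
  have h2 := pa_gauss_shift (χ ^ 2) ψ κ hκ
  have h3 : (χ ^ 2) κ⁻¹ = qc κ := by
    rw [MulChar.pow_apply' _ (by norm_num), hχ]
    have : κ⁻¹ = κ * (κ⁻¹) ^ 2 := by field_simp
    rw [this, qc_mul, qc_sq _ (inv_ne_zero hκ), mul_one]
  rw [← h3, ← h2]
  simp only [add_mul, one_mul, Finset.sum_add_distrib, h1, zero_add]
  refine Finset.sum_congr rfl fun u _ => ?_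
  rw [MulChar.pow_apply' _ (by norm_num), hχ, mul_comm κ]

lemma pa_SG (χ : MulChar F ℂ) (hχ : ∀ a, χ a ^ 2 = qc a) (ψ : AddChar F ℂ)
    (P : F → F) (hP : ∀ τ, P τ ≠ 0) :
    (∑ τ, χ (P τ)) * gaussSum (χ ^ 3) ψ = ∑ l : F, χ l ^ 3 * ∑ τ, ψ (l * P τ) := by
  rw [Finset.sum_mul]
  simp only [Finset.mul_sum]
  rw [Finset.sum_comm]
  refine Finset.sum_congr rfl fun τ _ => ?_
  have h := pa_gauss_shift (χ ^ 3) ψ (P τ) (hP τ)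
  simp only [MulChar.pow_apply' _ (show 3 ≠ 0 by norm_num)] at h
  rw [h]
  congr 1
  have h4 := pa_chi4 χ hχ _ (hP τ)
  have h1 : χ (P τ) * χ (P τ)⁻¹ = 1 := by rw [← map_mul, mul_inv_cancel₀ (hP τ), map_one]
  have h5 : χ (P τ) ^ 3 * χ (P τ)⁻¹ ^ 3 = 1 := by rw [← mul_pow, h1, one_pow]
  linear_combination (-χ (P τ)) * h5 + (χ (P τ)⁻¹ ^ 3) * h4

lemma pa_fin (S G y : ℂ) (q : ℂ) (hq : q ≠ 0) (hG : G * conj G = q) (hy : IsIntegral ℤ y)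
    (h : S * G * conj (S * G) = q ^ 2 * (y * conj y)) : IsIntegral ℤ (S * conj S / q) := by
  have : S * conj S / q = y * conj y := by
    rw [map_mul] at h
    field_simp
    apply mul_right_cancel₀ hq
    linear_combination h - (S * conj S) * hG
  rw [this]
  exact hy.mul (pa_conj_int hy)

lemma pa_eps [CharP F 3] (a γ : F) (ha : a ≠ 0) (hP : ∀ τ : F, τ ^ 3 + a * τ ^ 2 + γ ^ 3 ≠ 0) :
    ∃ ε : F, ε ≠ 0 ∧ -γ = a * ε ^ 2 := by
  have h3 := pa_three (F := F)
  have hγ : γ ≠ 0 := by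
    rintro rfl; exact hP 0 (by simp)
  by_contra hcon
  push Not at hcon
  have hinj : Function.Injective (fun σ : F => γ ^ 3 * σ ^ 3 + a * σ) := by
    intro x y hxy
    by_contra hne
    have hd : x - y ≠ 0 := sub_ne_zero.2 hne
    have h0 : (x - y) * (γ ^ 3 * (x - y) ^ 2 + a) = 0 := by
      simp only at hxy
      linear_combination hxy + (-γ ^ 3 * (x ^ 2 * y - x * y ^ 2)) * h3
    have h1 := (mul_eq_zero.1 h0).resolve_left hd
    refine hcon ((x - y) * γ ^ 2 / a) (div_ne_zero (mul_ne_zero hd (pow_ne_zero 2 hγ)) ha) ?_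
    field_simp
    linear_combination (-1) * h1
  obtain ⟨σ, hσ⟩ := (Finite.surjective_of_injective hinj) (-1)
  simp only at hσ
  have hσ0 : σ ≠ 0 := by
    rintro rfl
    simp at hσ
  apply hP σ⁻¹
  field_simp
  linear_combination hσ

lemma pa_div [CharP F 3] (χ : MulChar F ℂ) (hχ : ∀ a, χ a ^ 2 = qc a) (hχ2 : χ ^ 2 ≠ 1)
    (hχ3 : χ ^ 3 ≠ 1) (ψ : AddChar F ℂ) (hψ : ψ.IsPrimitive) (hψ3 : ∀ x, ψ (x ^ 3) = ψ x) (s : ℂ)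
    (hs0 : s ≠ 0) (hs : s ^ 2 = Fintype.card F) (hsc : conj s = s) (a b c : F)
    (hP : ∀ τ : F, τ ^ 3 + a * τ ^ 2 + b * τ + c ≠ 0) :
    IsIntegral ℤ ((∑ τ : F, χ (τ ^ 3 + a * τ ^ 2 + b * τ + c)) *
      conj (∑ τ : F, χ (τ ^ 3 + a * τ ^ 2 + b * τ + c)) / (Fintype.card F : ℂ)) := by
  have h3 := pa_three (F := F)
  have hq : (Fintype.card F : ℂ) ≠ 0 := by rw [← hs]; exact pow_ne_zero 2 hs0
  have hG := pa_gauss_norm (χ ^ 3) hχ3 ψ hψ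
  rcases eq_or_ne a 0 with rfl | ha
  · have hSG := pa_SG χ hχ ψ _ hP
    choose m hm using fun l : F => pa_lin ψ l (l * b)
    refine pa_fin _ _ (∑ l : F, χ l ^ 3 * (ψ (l * c) * m l)) _ hq hG ?_ ?_
    · exact IsIntegral.sum _ fun l _ => ((pa_chi_int χ hχ l).pow 3).mul
        ((pa_psi_int ψ _).mul (isIntegral_algebraMap (x := m l)))
    · have : (∑ τ : F, χ (τ ^ 3 + 0 * τ ^ 2 + b * τ + c)) * gaussSum (χ ^ 3) ψ =
          (Fintype.card F : ℂ) * (∑ l : F, χ l ^ 3 * (ψ (l * c) * m l)) := by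
        rw [hSG, Finset.mul_sum]
        refine Finset.sum_congr rfl fun l _ => ?_
        have : ∀ τ : F, ψ (l * (τ ^ 3 + 0 * τ ^ 2 + b * τ + c)) =
            ψ (l * c) * ψ (l * τ ^ 3 + l * b * τ) := by
          intro τ
          rw [← AddChar.map_add_eq_mul]; congr 1; ring
        rw [Finset.sum_congr rfl fun τ _ => this τ, ← Finset.mul_sum, hm]; ring
      rw [this, map_mul, Complex.conj_natCast]; ring
  · obtain ⟨γ, hγ⟩ : ∃ γ : F, γ ^ 3 = (b / a) ^ 3 + a * (b / a) ^ 2 + b * (b / a) + c := by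
      have : Function.Surjective (frobenius F 3) :=
        Finite.surjective_of_injective (frobenius_inj F 3)
      exact this _
    have hsh : ∀ τ : F, (τ + b / a) ^ 3 + a * (τ + b / a) ^ 2 + b * (τ + b / a) + c
        = τ ^ 3 + a * τ ^ 2 + γ ^ 3 := by
      intro τ
      rw [hγ]
      have hb : b = a * (b / a) := by field_simp
      generalize b / a = k at *
      rw [hb]
      linear_combination (τ ^ 2 * k + τ * k ^ 2 + a * k * τ) * h3
    have hS : ∑ τ : F, χ (τ ^ 3 + a * τ ^ 2 + b * τ + c) = ∑ τ : F, χ (τ ^ 3 + a * τ ^ 2 + γ ^ 3) := by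
      refine (Fintype.sum_equiv (Equiv.addRight (b / a)) _ _ fun τ => ?_).symm
      simp only [Equiv.coe_addRight, hsh]
    have hP' : ∀ τ : F, τ ^ 3 + a * τ ^ 2 + γ ^ 3 ≠ 0 := fun τ => hsh τ ▸ hP _
    rw [hS]
    obtain ⟨ε, hε0, hε⟩ := pa_eps a γ ha hP'
    have hγ0 : γ ≠ 0 := by
      rintro rfl; exact hP' 0 (by simp)
    obtain ⟨z, hz, hK⟩ := pa_K4 χ hχ ψ s hs0 hs ε
    have hg := pa_gauss_norm (χ ^ 2) hχ2 ψ hψ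
    have hSG := pa_SG χ hχ ψ _ hP'
    have key : (∑ τ : F, χ (τ ^ 3 + a * τ ^ 2 + γ ^ 3)) * gaussSum (χ ^ 3) ψ =
        gaussSum (χ ^ 2) ψ * χ a ^ 2 * χ (ε / γ) ^ 3 * (s * z) := by
      have e1 : ∑ l : F, χ l ^ 3 * ∑ τ, ψ (l * (τ ^ 3 + a * τ ^ 2 + γ ^ 3))
          = ∑ μ : F, χ (μ ^ 3) ^ 3 * ∑ τ, ψ (μ ^ 3 * (τ ^ 3 + a * τ ^ 2 + γ ^ 3)) :=
        (Function.Bijective.sum_comp (Finite.injective_iff_bijective.1 (frobenius_inj F 3))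
          (fun l => χ l ^ 3 * ∑ τ, ψ (l * (τ ^ 3 + a * τ ^ 2 + γ ^ 3)))).symm
      have e2 : ∀ μ : F, χ (μ ^ 3) ^ 3 * ∑ τ, ψ (μ ^ 3 * (τ ^ 3 + a * τ ^ 2 + γ ^ 3))
          = gaussSum (χ ^ 2) ψ * χ a ^ 2 * (χ μ ^ 3 * ψ (γ * μ - 1 / (a * μ))) := by
        intro μ
        rcases eq_or_ne μ 0 with rfl | hμ
        · simp [MulChar.map_zero]
        have e3 : ∀ τ : F, ψ (μ ^ 3 * (τ ^ 3 + a * τ ^ 2 + γ ^ 3))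
            = ψ (γ * μ - 1 / (a * μ)) * ψ (μ ^ 3 * a * (τ - 1 / (μ ^ 2 * a)) ^ 2) := by
          intro τ
          have : μ ^ 3 * (τ ^ 3 + a * τ ^ 2 + γ ^ 3) = (μ * τ) ^ 3 + μ ^ 3 * a * τ ^ 2 + (μ * γ) ^ 3 := by
            ring
          rw [this, AddChar.map_add_eq_mul, AddChar.map_add_eq_mul, hψ3, hψ3,
            ← AddChar.map_add_eq_mul, ← AddChar.map_add_eq_mul, ← AddChar.map_add_eq_mul]
          congr 1
          field_simp
          linear_combination (μ ^ 2 * a * τ) * h3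
        have e4 : ∑ τ : F, ψ (μ ^ 3 * a * (τ - 1 / (μ ^ 2 * a)) ^ 2)
            = ∑ τ : F, ψ (μ ^ 3 * a * τ ^ 2) :=
          Fintype.sum_equiv (Equiv.subRight (1 / (μ ^ 2 * a))) _ _ fun τ => rfl
        rw [Finset.sum_congr rfl fun τ _ => e3 τ, ← Finset.mul_sum, e4,
          pa_quad χ hχ ψ hψ _ (mul_ne_zero (pow_ne_zero 3 hμ) ha), ← hχ, map_mul, map_pow]
        have h4 := pa_chi4 χ hχ μ hμ
        have : (χ μ ^ 3) ^ 3 * (χ μ ^ 3) ^ 2 = χ μ ^ 3 := by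
          linear_combination (χ μ ^ 11 + χ μ ^ 7 + χ μ ^ 3) * h4
        linear_combination (ψ (γ * μ - 1 / (a * μ)) * χ a ^ 2 * gaussSum (χ ^ 2) ψ) * this
      have e5 : ∑ μ : F, χ μ ^ 3 * ψ (γ * μ - 1 / (a * μ))
          = χ (ε / γ) ^ 3 * ∑ l : F, χ l ^ 3 * ψ (ε * (l + l⁻¹)) := by
        rw [Finset.mul_sum]
        refine (Fintype.sum_equiv (Equiv.mulRight₀ (ε / γ) (div_ne_zero hε0 hγ0)) _ _
          fun l => ?_).symm
        change _ = χ (l * (ε / γ)) ^ 3 * ψ (γ * (l * (ε / γ)) - 1 / (a * (l * (ε / γ))))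
        rcases eq_or_ne l 0 with rfl | hl
        · simp [MulChar.map_zero]
        rw [map_mul χ, mul_pow, ← mul_assoc, mul_comm (χ (ε / γ) ^ 3)]
        congr 2
        field_simp
        linear_combination (-1) * hε
      rw [hSG, e1, Finset.sum_congr rfl fun μ _ => e2 μ, ← Finset.mul_sum, e5, hK]
      ring
    refine pa_fin _ _ z _ hq hG hz ?_
    have n1 := pa_chi_norm χ a ha
    have n2 := pa_chi_norm χ (ε / γ) (div_ne_zero hε0 hγ0)
    rw [key]
    simp only [map_mul, map_pow, hsc]
    have n1' : χ a ^ 2 * conj (χ a) ^ 2 = 1 := by rw [← mul_pow, n1, one_pow]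
    have n2' : χ (ε / γ) ^ 3 * conj (χ (ε / γ)) ^ 3 = 1 := by rw [← mul_pow, n2, one_pow]
    calc _ = (gaussSum (χ ^ 2) ψ * conj (gaussSum (χ ^ 2) ψ)) * (χ a ^ 2 * conj (χ a) ^ 2)
          * (χ (ε / γ) ^ 3 * conj (χ (ε / γ)) ^ 3) * (s ^ 2 * (z * conj z)) := by ring
      _ = _ := by rw [hg, n1', n2', hs]; ring
end PartA

section PartB
open ComplexConjugate

lemma pb_psi {F : Type*} [Field F] [Fintype F] [CharP F 3] :
    ∃ ψ : AddChar F ℂ, ψ.IsPrimitive ∧ ∀ x, ψ (x ^ 3) = ψ x := by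
  have : Fact (Nat.Prime 3) := ⟨by norm_num⟩
  let _ : Algebra (ZMod 3) F := ZMod.algebra F 3
  let ψ0 : AddChar (ZMod 3) ℂ := ZMod.stdAddChar
  have h0 : ψ0 ≠ 1 := by
    have := (ZMod.isPrimitive_stdAddChar 3) (a := 1) one_ne_zero
    intro h
    apply this
    change ψ0.mulShift 1 = 1
    rw [AddChar.mulShift_one, h]
  obtain ⟨y, hy⟩ := AddChar.ne_one_iff.1 h0
  obtain ⟨x, hx⟩ := Algebra.trace_surjective (ZMod 3) F y
  refine ⟨ψ0.compAddMonoidHom (Algebra.trace (ZMod 3) F).toAddMonoidHom, ?_, ?_⟩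
  · apply AddChar.IsPrimitive.of_ne_one
    intro h
    apply hy
    have := DFunLike.congr_fun h x
    rw [← hx]
    exact this
  · intro x
    change ψ0 (Algebra.trace (ZMod 3) F (x ^ 3)) = ψ0 (Algebra.trace (ZMod 3) F x)
    congr 1
    have := Algebra.trace_eq_of_algEquiv (FiniteField.frobeniusAlgEquivOfAlgebraic (ZMod 3) F) x
    rw [← this]
    simp [ZMod.card]

lemma pb_chi {F : Type*} [Field F] [Fintype F] [DecidableEq F] [CharP F 3]
    (h4 : 4 ∣ Fintype.card F - 1) :
    ∃ χ : MulChar F ℂ, (∀ a, χ a ^ 2 = qc a) ∧ χ ^ 2 ≠ 1 ∧ χ ^ 3 ≠ 1 := by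
  obtain ⟨χ, hχ⟩ := MulChar.exists_mulChar_orderOf F h4 (Complex.isPrimitiveRoot_I)
  have h2 : χ ^ 2 ≠ 1 := pow_ne_one_of_lt_orderOf (by norm_num) (by rw [hχ]; norm_num)
  have h3 : χ ^ 3 ≠ 1 := pow_ne_one_of_lt_orderOf (by norm_num) (by rw [hχ]; norm_num)
  have h4 : ∀ a : F, a ≠ 0 → χ a ^ 4 = 1 := by
    intro a ha
    rw [← MulChar.pow_apply' _ (by norm_num), ← hχ, pow_orderOf_eq_one, MulChar.one_apply ha.isUnit]
  have hsq : ∀ a : F, a ≠ 0 → IsSquare a → χ a ^ 2 = 1 := by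
    rintro a ha ⟨b, rfl⟩
    have hb : b ≠ 0 := by rintro rfl; simp at ha
    rw [map_mul, ← h4 b hb]; ring
  refine ⟨χ, ?_, h2, h3⟩
  intro a
  rcases eq_or_ne a 0 with rfl | ha
  · simp [qc_zero, MulChar.map_zero]
  by_cases hs : IsSquare a
  · rw [hsq a ha hs, qc, (quadraticChar_one_iff_isSquare ha).2 hs]; simp
  · have hq := quadraticChar_neg_one_iff_not_isSquare.2 hs
    rw [qc, hq]
    have : (χ a ^ 2 - 1) * (χ a ^ 2 + 1) = 0 := by linear_combination h4 a ha
    rcases mul_eq_zero.1 this with h | h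
    · exfalso
      apply h2
      ext c
      have hc : (c : F) ≠ 0 := c.ne_zero
      rw [MulChar.pow_apply' _ (by norm_num), MulChar.one_apply_coe]
      by_cases hcs : IsSquare (c : F)
      · exact hsq _ hc hcs
      · have hc1 := quadraticChar_neg_one_iff_not_isSquare.2 hcs
        have : IsSquare (a * c) := by
          rw [← quadraticChar_one_iff_isSquare (mul_ne_zero ha hc), map_mul, hq, hc1]; norm_num
        have := hsq _ (mul_ne_zero ha hc) this
        rw [map_mul] at this
        linear_combination this - (χ c ^ 2) * h
    · push_cast; linear_combination h

lemma pb_reim {F : Type*} [Field F] [Fintype F] [DecidableEq F]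
    (χ : MulChar F ℂ) (hχ : ∀ a, χ a ^ 2 = qc a) :
    ∃ α β : F → ℤ, (∀ x, χ x = α x + β x * Complex.I) ∧ ∀ x, x ≠ 0 → (α x + β x) ^ 2 = 1 := by
  have : ∀ x : F, ∃ p : ℤ × ℤ, χ x = p.1 + p.2 * Complex.I ∧ (x ≠ 0 → (p.1 + p.2) ^ 2 = 1) := by
    intro x
    rcases eq_or_ne x 0 with rfl | hx
    · exact ⟨(0, 0), by simp [MulChar.map_zero], by simp⟩
    have h := pa_chi4 χ hχ x hx
    have h' : (χ x - 1) * ((χ x + 1) * ((χ x - Complex.I) * (χ x + Complex.I))) = 0 := by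
      linear_combination h - (χ x ^ 2 - 1) * Complex.I_sq
    rcases mul_eq_zero.1 h' with h | h
    · exact ⟨(1, 0), by simp; linear_combination h, by simp⟩
    rcases mul_eq_zero.1 h with h | h
    · exact ⟨(-1, 0), by simp; linear_combination h, by simp⟩
    rcases mul_eq_zero.1 h with h | h
    · exact ⟨(0, 1), by simp; linear_combination h, by simp⟩
    · exact ⟨(0, -1), by simp; linear_combination h, by simp⟩
  choose p hp using this
  exact ⟨fun x => (p x).1, fun x => (p x).2, fun x => (hp x).1, fun x => (hp x).2⟩

lemma pb_poly {F E : Type*} [Field F] [Field E] [Algebra F E]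
    (hE : Module.finrank F E = 3) (t : E) :
    ∃ a b c : F, ∀ τ : F, Algebra.norm F (t + algebraMap F E τ) = τ ^ 3 + a * τ ^ 2 + b * τ + c := by
  have : FiniteDimensional F E := FiniteDimensional.of_finrank_pos (by omega)
  set P := (Algebra.lmul F E (-t)).charpoly with hP
  have hdeg : P.natDegree = 3 := by rw [hP, LinearMap.charpoly_natDegree, hE]
  have hmon : P.Monic := LinearMap.charpoly_monic _
  refine ⟨P.coeff 2, P.coeff 1, P.coeff 0, fun τ => ?_⟩
  have h1 : P.eval τ = Algebra.norm F (t + algebraMap F E τ) := by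
    rw [hP, LinearMap.eval_charpoly, Algebra.norm_apply]
    congr 1
    ext x
    simp [Algebra.smul_def]
    ring
  have h3 : P.coeff 3 = 1 := by rw [← hdeg]; exact hmon
  rw [← h1, Polynomial.eval_eq_sum_range, hdeg]
  simp [Finset.sum_range_succ, h3]
  ring

lemma pb_desc (e : ℕ) : ∀ A B : ℤ, A ^ 2 + B ^ 2 = 3 ^ (2 * e) → A * B = 0 := by
  induction e with
  | zero =>
    intro A B h
    simp at h
    by_contra hne
    have hA : A ≠ 0 := left_ne_zero_of_mul hne
    have hB : B ≠ 0 := right_ne_zero_of_mul hne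
    have := sq_pos_of_ne_zero hA
    have := sq_pos_of_ne_zero hB
    omega
  | succ e ih =>
    intro A B h
    have h9 : (3:ℤ) ^ (2 * (e + 1)) = 9 * 3 ^ (2 * e) := by rw [mul_add, pow_add]; ring
    have hd : (3:ℤ) ∣ A ∧ 3 ∣ B := by
      have hmod : (A ^ 2 + B ^ 2) % 3 = 0 := by rw [h, h9]; omega
      rw [sq, sq, Int.add_emod, Int.mul_emod A A, Int.mul_emod B B] at hmod
      have a3 : A % 3 = 0 ∨ A % 3 = 1 ∨ A % 3 = 2 := by omega
      have b3 : B % 3 = 0 ∨ B % 3 = 1 ∨ B % 3 = 2 := by omega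
      rcases a3 with a | a | a <;> rcases b3 with b | b | b <;> rw [a, b] at hmod <;>
        (constructor <;> omega)
    obtain ⟨⟨a, rfl⟩, ⟨b, rfl⟩⟩ := hd
    have := ih a b (by rw [h9] at h; linarith)
    linear_combination 9 * this

end PartB

section PartB2
open ComplexConjugate

/-- the lift of a multiplicative character through the norm -/
noncomputable def liftChar {F E : Type*} [Field F] [Field E] [Algebra F E] [FiniteDimensional F E]
    (χ : MulChar F ℂ) : MulChar E ℂ where
  toMonoidHom := χ.toMonoidHom.comp (Algebra.norm F)
  map_nonunit' := by
    intro a ha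
    have : a = 0 := by
      by_contra h; exact ha (isUnit_iff_ne_zero.2 h)
    subst this
    change χ (Algebra.norm F (0:E)) = 0
    rw [Algebra.norm_zero, MulChar.map_zero]

lemma pb_R {E : Type*} [Field E] [Fintype E] [DecidableEq E] (φ : MulChar E ℂ) (hφ : φ ≠ 1) (d : E) :
    ∑ t : E, φ t * φ⁻¹ (t + d) = if d = 0 then (Fintype.card E : ℂ) - 1 else -1 := by
  split_ifs with hd
  · subst hd
    rw [← Finset.add_sum_erase _ _ (Finset.mem_univ (0:E)), MulChar.map_zero, zero_mul, zero_add]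
    rw [Finset.sum_congr rfl (g := fun _ => (1:ℂ))]
    · simp only [Finset.sum_const, Finset.card_erase_of_mem (Finset.mem_univ (0:E)),
        Finset.card_univ, nsmul_eq_mul, mul_one]
      rw [Nat.cast_sub Fintype.card_pos]; simp
    · intro x hx
      rw [add_zero, ← MulChar.mul_apply, mul_inv_cancel, MulChar.one_apply]
      exact (Finset.ne_of_mem_erase hx).isUnit
  · have h := jacobiSum_nontrivial_inv hφ
    rw [jacobiSum] at h
    have h2 : ∑ t : E, φ t * φ⁻¹ (t + d) = ∑ x : E, φ (-1) * (φ x * φ⁻¹ (1 - x)) := by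
      refine (Fintype.sum_equiv (Equiv.mulRight₀ (-d) (neg_ne_zero.2 hd)) _ _ fun x => ?_).symm
      change _ = φ (x * (-d)) * φ⁻¹ (x * (-d) + d)
      have e1 : x * (-d) + d = d * (1 - x) := by ring
      have e2 : x * (-d) = -1 * (x * d) := by ring
      rw [e1, e2, map_mul φ, map_mul φ, map_mul φ⁻¹]
      have : φ d * φ⁻¹ d = 1 := by
        rw [← MulChar.mul_apply, mul_inv_cancel, MulChar.one_apply (Ne.isUnit hd)]
      linear_combination (-(φ (-1) * φ x * φ⁻¹ (1 - x))) * this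
    rw [h2, ← Finset.mul_sum, h]
    have : φ (-1) * φ (-1) = 1 := by rw [← map_mul]; simp
    linear_combination -this

lemma pb_avg {F E : Type*} [Field F] [Fintype F] [DecidableEq F] [Field E] [Fintype E]
    [DecidableEq E] [Algebra F E] (φ : MulChar E ℂ) (hφ : φ ≠ 1) :
    ∑ t : E, (∑ τ : F, φ (t + algebraMap F E τ)) * conj (∑ τ : F, φ (t + algebraMap F E τ))
      = (Fintype.card F : ℂ) * (Fintype.card E - Fintype.card F) := by
  have h1 : ∀ t : E, (∑ τ : F, φ (t + algebraMap F E τ)) * conj (∑ τ : F, φ (t + algebraMap F E τ))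
      = ∑ τ : F, ∑ δ : F, φ (t + algebraMap F E τ) *
          φ⁻¹ (t + algebraMap F E τ + algebraMap F E δ) := by
    intro t
    rw [map_sum, Finset.sum_mul_sum]
    refine Finset.sum_congr rfl fun τ _ => ?_
    refine (Fintype.sum_equiv (Equiv.addLeft τ) _ _ fun δ => ?_).symm
    have : conj (φ (t + algebraMap F E (τ + δ))) = φ⁻¹ (t + algebraMap F E (τ + δ)) :=
      MulChar.star_apply' φ _
    simp only [Equiv.coe_addLeft]
    rw [this, map_add (algebraMap F E), add_assoc t]
  rw [Finset.sum_congr rfl fun t _ => h1 t, Finset.sum_comm]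
  have h2 : ∀ τ : F, ∑ t : E, ∑ δ : F, φ (t + algebraMap F E τ) *
          φ⁻¹ (t + algebraMap F E τ + algebraMap F E δ) = Fintype.card E - Fintype.card F := by
    intro τ
    rw [Finset.sum_comm]
    have h3 : ∀ δ : F, ∑ t : E, φ (t + algebraMap F E τ) *
          φ⁻¹ (t + algebraMap F E τ + algebraMap F E δ)
          = if δ = 0 then (Fintype.card E : ℂ) - 1 else -1 := by
      intro δ
      have := pb_R φ hφ (algebraMap F E δ)
      simp only [map_eq_zero] at this
      rw [← this]
      exact Fintype.sum_equiv (Equiv.addRight (algebraMap F E τ)) _ _ fun t => rfl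
    rw [Finset.sum_congr rfl fun δ _ => h3 δ]
    have h4 : ∀ δ : F, (if δ = 0 then (Fintype.card E : ℂ) - 1 else -1)
        = (if δ = 0 then (Fintype.card E : ℂ) else 0) - 1 := by
      intro δ; split_ifs <;> ring
    rw [Finset.sum_congr rfl fun δ _ => h4 δ, Finset.sum_sub_distrib, Finset.sum_ite_eq']
    simp
  rw [Finset.sum_congr rfl fun τ _ => h2 τ]
  simp [mul_sub]

lemma pb_odd {ι : Type*} (s : Finset ι) (g : ι → ℤ) (hg : ∀ i ∈ s, g i ^ 2 = 1) (hs : Odd s.card) :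
    Odd (∑ i ∈ s, g i) := by
  have h : ∀ i ∈ s, g i ≡ 1 [ZMOD 2] := by
    intro i hi
    rcases sq_eq_one_iff.1 (hg i hi) with h | h <;> rw [h] <;> decide
  have h2 : ∑ i ∈ s, g i ≡ ∑ i ∈ s, 1 [ZMOD 2] := Int.ModEq.sum h
  rw [Finset.sum_const, nsmul_eq_mul, mul_one] at h2
  obtain ⟨k, hk⟩ := hs
  rw [hk] at h2
  rw [Int.odd_iff]
  unfold Int.ModEq at h2
  omega

lemma pb_dvd (n : ℤ) (q : ℕ) (hq : q ≠ 0) (h : IsIntegral ℤ ((n : ℂ) / (q : ℂ))) : (q : ℤ) ∣ n := by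
  have h1 : ((n : ℂ) / (q : ℂ)) = algebraMap ℚ ℂ ((n : ℚ) / (q : ℚ)) := by simp
  rw [h1, isIntegral_algebraMap_iff (algebraMap ℚ ℂ).injective] at h
  obtain ⟨y, hy⟩ := IsIntegrallyClosed.isIntegral_iff.1 h
  refine ⟨y, ?_⟩
  have hq' : (q : ℚ) ≠ 0 := by exact_mod_cast hq
  have : (n : ℚ) = q * y := by
    simp only [eq_intCast] at hy
    rw [hy]; field_simp
  exact_mod_cast this

lemma pb_val {F E : Type*} [Field F] [Fintype F] [DecidableEq F] [Field E] [Fintype E]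
    [Algebra F E] [CharP F 3] (hE : Module.finrank F E = 3) (e : ℕ)
    (hF : Fintype.card F = 3 ^ (2 * e))
    (χ : MulChar F ℂ) (hχ : ∀ a, χ a ^ 2 = qc a) (hχ2 : χ ^ 2 ≠ 1) (hχ3 : χ ^ 3 ≠ 1)
    (α β : F → ℤ) (h1 : ∀ x, χ x = α x + β x * Complex.I)
    (h2 : ∀ x, x ≠ 0 → (α x + β x) ^ 2 = 1) (t : E) (ht : t ∉ Set.range (algebraMap F E)) :
    (∑ τ : F, χ (Algebra.norm F (t + algebraMap F E τ))) *
      conj (∑ τ : F, χ (Algebra.norm F (t + algebraMap F E τ))) = (Fintype.card F : ℂ) := by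
  classical
  have : FiniteDimensional F E := FiniteDimensional.of_finrank_pos (by omega)
  set N := fun x : E => Algebra.norm F x with hN
  set A : E → ℤ := fun t => ∑ τ : F, α (N (t + algebraMap F E τ)) with hA
  set B : E → ℤ := fun t => ∑ τ : F, β (N (t + algebraMap F E τ)) with hB
  have hS : ∀ t : E, ∑ τ : F, χ (N (t + algebraMap F E τ)) = A t + B t * Complex.I := by
    intro t
    simp only [h1, hA, hB]
    rw [Finset.sum_add_distrib, ← Finset.sum_mul]; push_cast; rfl
  have hSS : ∀ t : E, (∑ τ : F, χ (N (t + algebraMap F E τ))) *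
      conj (∑ τ : F, χ (N (t + algebraMap F E τ))) = ((A t ^ 2 + B t ^ 2 : ℤ) : ℂ) := by
    intro t
    rw [hS]
    simp only [map_add, map_mul, map_intCast, Complex.conj_I]
    push_cast
    linear_combination (-(B t : ℂ) ^ 2) * Complex.I_sq
  have hcE : Fintype.card E = Fintype.card F ^ 3 := by
    rw [← hE]; exact Module.card_eq_pow_finrank
  obtain ⟨ψ, hψ, hψ3⟩ := pb_psi (F := F)
  have hnr : ∀ t : E, t ∉ Set.range (algebraMap F E) → ∀ τ : F, N (t + algebraMap F E τ) ≠ 0 := by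
    intro t ht τ h
    have : t + algebraMap F E τ = 0 := Algebra.norm_eq_zero_iff.1 h
    exact ht ⟨-τ, by rw [map_neg]; linear_combination -this⟩
  have hlow : ∀ t : E, t ∉ Set.range (algebraMap F E) →
      (Fintype.card F : ℤ) ≤ A t ^ 2 + B t ^ 2 := by
    intro t ht
    obtain ⟨a, b, c, habc⟩ := pb_poly hE t
    have hintg := pa_div χ hχ hχ2 hχ3 ψ hψ hψ3 (3 ^ e) (pow_ne_zero e (by norm_num))
      (by rw [hF]; push_cast; ring) (by rw [map_pow, Complex.conj_ofNat]) a b c (fun τ => by rw [← habc]; exact hnr t ht τ)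
    simp only [← habc] at hintg
    have h5 := hSS t
    simp only [hN] at h5
    rw [h5] at hintg
    have hdvd := pb_dvd _ _ Fintype.card_ne_zero hintg
    refine Int.le_of_dvd ?_ hdvd
    have hodd : Odd (A t + B t) := by
      simp only [hA, hB]
      rw [← Finset.sum_add_distrib]
      refine pb_odd _ _ (fun τ _ => h2 _ (hnr t ht τ)) ?_
      rw [Finset.card_univ, hF]
      exact Odd.pow (by decide)
    by_contra hcon
    have hA0 : A t = 0 := by nlinarith [sq_nonneg (A t), sq_nonneg (B t)]
    have hB0 : B t = 0 := by nlinarith [sq_nonneg (A t), sq_nonneg (B t)]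
    rw [hA0, hB0] at hodd
    exact absurd hodd (by decide)
  have hzero : ∀ x : F, A (algebraMap F E x) ^ 2 + B (algebraMap F E x) ^ 2 = 0 := by
    intro x
    have h6 : ∑ τ : F, χ (N (algebraMap F E x + algebraMap F E τ)) = 0 := by
      rw [← MulChar.sum_eq_zero_of_ne_one hχ3]
      refine Fintype.sum_equiv (Equiv.addLeft x) _ _ fun τ => ?_
      simp only [hN, Equiv.coe_addLeft]
      rw [← map_add, Algebra.norm_algebraMap, hE, map_pow, MulChar.pow_apply' _ (by norm_num)]
    have := hSS (algebraMap F E x)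
    rw [h6, zero_mul] at this
    exact_mod_cast this.symm
  have hφ1 : (liftChar χ : MulChar E ℂ) ≠ 1 := by
    intro h
    apply hχ3
    ext x
    have h7 : (liftChar χ : MulChar E ℂ) (algebraMap F E x) = χ (N (algebraMap F E x)) := rfl
    rw [h, MulChar.one_apply] at h7
    · simp only [hN] at h7
      rw [Algebra.norm_algebraMap, hE, map_pow] at h7
      rw [MulChar.pow_apply' _ (by norm_num), ← h7, MulChar.one_apply_coe]
    · exact (x.isUnit).map _
  have havg := pb_avg (F := F) (liftChar χ : MulChar E ℂ) hφ1
  have havg2 : ∑ t : E, (A t ^ 2 + B t ^ 2) = (Fintype.card F : ℤ) * (Fintype.card E - Fintype.card F) := by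
    have : ∑ t : E, ((A t ^ 2 + B t ^ 2 : ℤ) : ℂ) = (Fintype.card F : ℂ) * (Fintype.card E - Fintype.card F) := by
      rw [← havg]
      exact Finset.sum_congr rfl fun t _ => (hSS t).symm
    exact_mod_cast this
  set R : Finset E := Finset.univ.image (algebraMap F E) with hR
  have hRc : R.card = Fintype.card F := by
    rw [hR, Finset.card_image_of_injective _ (algebraMap F E).injective, Finset.card_univ]
  have hmemR : ∀ t, t ∈ R ↔ t ∈ Set.range (algebraMap F E) := by
    intro t; simp [hR]
  have hsum0 : ∑ t ∈ Rᶜ, (A t ^ 2 + B t ^ 2 - (Fintype.card F : ℤ)) = 0 := by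
    rw [Finset.sum_sub_distrib, Finset.sum_const, Finset.card_compl, hRc, nsmul_eq_mul,
      Nat.cast_sub (by rw [hcE]; exact Nat.le_self_pow (by norm_num) _)]
    rw [← Finset.sum_add_sum_compl R] at havg2
    have : ∑ t ∈ R, (A t ^ 2 + B t ^ 2) = 0 := by
      refine Finset.sum_eq_zero fun t ht => ?_
      obtain ⟨x, rfl⟩ := (hmemR t).1 ht
      exact hzero x
    rw [this, zero_add] at havg2
    rw [havg2]; ring
  have hfin := (Finset.sum_eq_zero_iff_of_nonneg (fun t ht => sub_nonneg.2 (hlow t (fun h => by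
    rw [Finset.mem_compl, hmemR] at ht; exact ht h)))).1 hsum0 t (by
      rw [Finset.mem_compl, hmemR]; exact ht)
  rw [hSS, sub_eq_zero.1 hfin]
  push_cast; rfl
end PartB2

section PartC
open ComplexConjugate

lemma pc_f {F E : Type*} [Field F] [Fintype F] [DecidableEq F] [Field E] [Fintype E]
    [Algebra F E] [CharP F 3] (hE : Module.finrank F E = 3) (e : ℕ)
    (hF : Fintype.card F = 3 ^ (2 * e)) :
    ∃ f : F × F → ℤ, (∀ p, f p ^ 2 = 1) ∧
      ∀ a d : F × F, d ≠ 0 → (∑ t : F, f (a + t • d)) ^ 2 = ((3 ^ (2 * e) : ℕ) : ℤ) := by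
  have : FiniteDimensional F E := FiniteDimensional.of_finrank_pos (by omega)
  have h4 : 4 ∣ Fintype.card F - 1 := by
    rw [hF, pow_mul]
    have := Nat.sub_dvd_pow_sub_pow 9 1 e
    rw [one_pow] at this
    exact Dvd.dvd.trans (by norm_num) this
  obtain ⟨χ, hχ, hχ2, hχ3⟩ := pb_chi (F := F) h4
  obtain ⟨α, β, h1, h2⟩ := pb_reim χ hχ
  let b := Module.finBasisOfFinrankEq F E hE
  have hli : ∀ x y z : F, x • b 0 + y • b 1 + z • b 2 = 0 → x = 0 ∧ y = 0 ∧ z = 0 := by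
    intro x y z h
    have := Fintype.linearIndependent_iff.1 b.linearIndependent ![x, y, z]
      (by simpa [Fin.sum_univ_three] using h)
    exact ⟨this 0, this 1, this 2⟩
  set v : F × F → E := fun p => b 0 + p.1 • b 1 + p.2 • b 2 with hv
  have hv0 : ∀ p, v p ≠ 0 := by
    intro p h
    have := hli 1 p.1 p.2 (by rw [one_smul]; exact h)
    exact one_ne_zero this.1
  have hN0 : ∀ p, Algebra.norm F (v p) ≠ 0 := fun p h => hv0 p (Algebra.norm_eq_zero_iff.1 h)
  refine ⟨fun p => α (Algebra.norm F (v p)) + β (Algebra.norm F (v p)), fun p => h2 _ (hN0 p), ?_⟩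
  intro a d hd
  set w : E := d.1 • b 1 + d.2 • b 2 with hw
  have hw0 : w ≠ 0 := by
    intro h
    have := hli 0 d.1 d.2 (by rw [zero_smul, zero_add]; exact h)
    exact hd (Prod.ext this.2.1 this.2.2)
  have hline : ∀ t : F, v (a + t • d) = w * (v a / w + algebraMap F E t) := by
    intro t
    rw [mul_add, mul_div_cancel₀ _ hw0, mul_comm w, ← Algebra.smul_def, hw]
    simp only [hv, Prod.fst_add, Prod.snd_add, Prod.smul_fst, Prod.smul_snd, smul_eq_mul, add_smul,
      smul_add, mul_smul]
    abel
  have hrange : v a / w ∉ Set.range (algebraMap F E) := by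
    rintro ⟨c, hc⟩
    have hc' : v a = c • w := by
      rw [Algebra.smul_def, hc]; field_simp
    have := hli 1 (a.1 - c * d.1) (a.2 - c * d.2) (by
      simp only [hv, hw] at hc'
      rw [one_smul, sub_smul, sub_smul, mul_smul, mul_smul]
      rw [smul_add] at hc'
      linear_combination hc')
    exact one_ne_zero this.1
  have hval := pb_val hE e hF χ hχ hχ2 hχ3 α β h1 h2 _ hrange
  set A : ℤ := ∑ t : F, α (Algebra.norm F (v (a + t • d))) with hA
  set B : ℤ := ∑ t : F, β (Algebra.norm F (v (a + t • d))) with hB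
  have hS : χ (Algebra.norm F w) * ∑ τ : F, χ (Algebra.norm F (v a / w + algebraMap F E τ))
      = A + B * Complex.I := by
    rw [Finset.mul_sum, hA, hB]
    push_cast
    rw [Finset.sum_mul, ← Finset.sum_add_distrib]
    refine Finset.sum_congr rfl fun t _ => ?_
    rw [← h1, hline t, map_mul (Algebra.norm F), map_mul χ]
  have hn := pa_chi_norm χ (Algebra.norm F w) (fun h => hw0 (Algebra.norm_eq_zero_iff.1 h))
  have hAB : A ^ 2 + B ^ 2 = 3 ^ (2 * e) := by
    have h5 : ((A:ℂ) + B * Complex.I) * conj ((A:ℂ) + B * Complex.I) = Fintype.card F := by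
      rw [← hS, map_mul]
      rw [mul_mul_mul_comm, hn, hval, one_mul]
    simp only [map_add, map_mul, map_intCast, Complex.conj_I] at h5
    have h6 : ((A ^ 2 + B ^ 2 : ℤ) : ℂ) = ((3 ^ (2 * e) : ℤ) : ℂ) := by
      rw [hF] at h5
      push_cast at h5 ⊢
      linear_combination h5 + (B : ℂ) ^ 2 * Complex.I_sq
    exact_mod_cast h6
  have := pb_desc e A B hAB
  rw [Finset.sum_add_distrib, ← hA, ← hB]
  push_cast
  linear_combination hAB + 2 * this

end PartC

/-- For every positive integer `e`, with `q = 3^{2e}`, the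
affine plane `AG(2,q)` (point set `𝔽_q × 𝔽_q`, lines `{a + t·d : t ∈ 𝔽_q}` for
`d ≠ 0`) contains a set `K` of type `((q − 3^e)/2, (q + 3^e)/2)` of size
`(q² − q)/2`: every affine line meets `K` in exactly `(q − 3^e)/2` or exactly
`(q + 3^e)/2` points, and both intersection sizes occur. -/
theorem stmt_19 (e : ℕ) (he : 0 < e)
    {F : Type*} [Field F] [Fintype F] (hF : Fintype.card F = 3 ^ (2 * e)) :
    ∃ K : Set (F × F),
      K.ncard = (3 ^ (2 * e) * 3 ^ (2 * e) - 3 ^ (2 * e)) / 2 ∧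
      (∀ a d : F × F, d ≠ 0 →
        {x ∈ K | ∃ t : F, x = a + t • d}.ncard = (3 ^ (2 * e) - 3 ^ e) / 2 ∨
        {x ∈ K | ∃ t : F, x = a + t • d}.ncard = (3 ^ (2 * e) + 3 ^ e) / 2) ∧
      (∃ a d : F × F, d ≠ 0 ∧
        {x ∈ K | ∃ t : F, x = a + t • d}.ncard = (3 ^ (2 * e) - 3 ^ e) / 2) ∧
      (∃ a d : F × F, d ≠ 0 ∧
        {x ∈ K | ∃ t : F, x = a + t • d}.ncard = (3 ^ (2 * e) + 3 ^ e) / 2) := by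
  classical
  have : Fact (Nat.Prime 3) := ⟨by norm_num⟩
  have : CharP F 3 := charP_of_card_eq_prime_pow hF
  have : Fintype (FiniteField.Extension F 3 3) := Fintype.ofFinite _
  obtain ⟨f, hf, hL⟩ := pc_f (E := FiniteField.Extension F 3 3)
    (FiniteField.finrank_extension F 3 3) e hF
  exact pd_main e he hF f hf hL
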